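/- Let X be a Markov chain on [0,∞) with transition kernel K ∈ D(G) where G({0}) = 0, let m ≥ 1, and let u_t = u(t) be a nonnegative function with u_t → u > 0 as t → ∞. Then the conditional laws P_{tu_t}[(X_1/t, …, X_m/t) ∈ ·] converge weakly on [0,∞]^m, as t → ∞, to P_u[(T*_1, …, T*_m) ∈ ·]. -/

import Mathlib

open MeasureTheory ProbabilityTheory Filter Topology
open scoped NNReal ENNReal

noncomputable section

/-- `K ∈ D(G)`: the transition kernel `K` is in the domain of attraction of `G`, i.e.
`K(t, t·)` converges weakly to `G` on the compactified half-line `[0,∞]` as `t → ∞`. -/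
def KernelDOA (K : Kernel ℝ≥0 ℝ≥0) (G : Measure ℝ≥0) : Prop :=
  ∀ f : C(ℝ≥0∞, ℝ),
    Tendsto (fun t : ℝ≥0 => ∫ x, f ((x / t : ℝ≥0) : ℝ≥0∞) ∂(K t))
      atTop (𝓝 (∫ x, f (x : ℝ≥0∞) ∂G))

/-- The law of `(X_1, …, X_m)` for the Markov chain with transition kernel `K`
started from `X_0 = y`. -/
def jointLaw (K : Kernel ℝ≥0 ℝ≥0) : (m : ℕ) → ℝ≥0 → Measure (Fin m → ℝ≥0)
  | 0, _ => Measure.dirac (fun i => i.elim0)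
  | m + 1, y => (K y).bind (fun x1 => (jointLaw K m x1).map (Fin.cons x1))

/-- The law of `(T*_1, …, T*_m)` for the tail chain associated with `(G, δ_0)`
started from `T*_0 = u`: `T*_n = u ξ_1 ⋯ ξ_n` with `ξ_i` i.i.d. of law `G`. -/
def tailChainLaw (G : Measure ℝ≥0) [IsProbabilityMeasure G] (m : ℕ) (u : ℝ≥0) :
    Measure (Fin m → ℝ≥0) :=
  (Measure.pi fun _ : Fin m => G).map
    (fun ξ (i : Fin m) => u * ∏ j ∈ Finset.Iic i, ξ j)

/-- Pointwise limits of a family converging continuously on an open set are continuous there. -/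
theorem continuousOn_of_tendsto_prod_nhds {ι E F : Type*} [TopologicalSpace E]
    [PseudoMetricSpace F] {l : Filter ι} [l.NeBot] {U : Set E} (hU : IsOpen U)
    {ψ : ι → E → F} {φ : E → F}
    (h : ∀ x ∈ U, Tendsto (fun p : ι × E => ψ p.1 p.2) (l ×ˢ 𝓝 x) (𝓝 (φ x))) :
    ContinuousOn φ U := by
  have hpt : ∀ x ∈ U, Tendsto (fun i => ψ i x) l (𝓝 (φ x)) := fun x hx =>
    (h x hx).comp (tendsto_id.prodMk (tendsto_const_nhds))
  intro x hx
  refine ContinuousAt.continuousWithinAt (Metric.tendsto_nhds.2 fun ε hε => ?_)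
  have h1 := Metric.tendsto_nhds.1 (h x hx) (ε / 2) (half_pos hε)
  have h2 : ∀ᶠ y in 𝓝 x, ∀ᶠ i in l, dist (ψ i y) (φ x) < ε / 2 :=
    (eventually_swap_iff.1 h1).curry
  filter_upwards [h2, hU.mem_nhds hx] with y hy hyU
  have : dist (φ y) (φ x) ≤ ε / 2 :=
    le_of_tendsto ((hpt y hyU).dist tendsto_const_nhds) (hy.mono fun _ => le_of_lt)
  linarith

/-- An extended continuous mapping theorem: integrals of uniformly bounded functions converging
continuously on an open set of full limit measure converge under weak convergence. -/
theorem tendsto_integral_of_tendsto_prod_nhds {ι E : Type*} [TopologicalSpace E]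
    [T2Space E] [CompactSpace E] [MeasurableSpace E] [BorelSpace E]
    {l : Filter ι} [l.NeBot] {μ : ι → Measure E} [∀ i, IsProbabilityMeasure (μ i)]
    {ν : Measure E} [IsProbabilityMeasure ν] [ν.Regular]
    (hμ : ∀ f : C(E, ℝ), Tendsto (fun i => ∫ x, f x ∂μ i) l (𝓝 (∫ x, f x ∂ν)))
    {U : Set E} (hU : IsOpen U) (hνU : ν Uᶜ = 0)
    {ψ : ι → E → ℝ} {φ : E → ℝ} {C : ℝ} (hψm : ∀ i, Measurable (ψ i))
    (hψC : ∀ i x, |ψ i x| ≤ C)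
    (h : ∀ x ∈ U, Tendsto (fun p : ι × E => ψ p.1 p.2) (l ×ˢ 𝓝 x) (𝓝 (φ x))) :
    Tendsto (fun i => ∫ x, ψ i x ∂μ i) l (𝓝 (∫ x, φ x ∂ν)) := by
  have hφ : ContinuousOn φ U := continuousOn_of_tendsto_prod_nhds hU h
  have hUae : ∀ᵐ x ∂ν, x ∈ U := hνU
  have hφC : ∀ x ∈ U, |φ x| ≤ C := fun x hx =>
    le_of_tendsto (((h x hx).comp
      (tendsto_id.prodMk (tendsto_const_nhds))).abs)
      (Eventually.of_forall fun i => hψC i x)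
  have hφm : AEStronglyMeasurable φ ν := by
    have := hφ.aestronglyMeasurable hU.measurableSet (μ := ν)
    rwa [Measure.restrict_eq_self_of_ae_mem hUae] at this
  have hφi : Integrable φ ν :=
    Integrable.of_bound hφm C (hUae.mono fun x hx => hφC x hx)
  have hψi : ∀ i, Integrable (ψ i) (μ i) := fun i =>
    Integrable.of_bound (hψm i).aestronglyMeasurable C (Eventually.of_forall fun x => hψC i x)
  obtain ⟨i₀⟩ : Nonempty ι := l.nonempty_of_neBot
  obtain ⟨x₀⟩ : Nonempty E := (μ i₀).nonempty_of_neZero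
  have hC : 0 ≤ C := (abs_nonneg _).trans (hψC i₀ x₀)
  rw [Metric.tendsto_nhds]
  intro ε hε
  obtain ⟨δ, hδ, hδε⟩ : ∃ δ > 0, 2 * C * δ + C * δ + 2 * δ < ε := by
    refine ⟨ε / (2 * (3 * C + 2)), by positivity, ?_⟩
    have : 2 * C * (ε / (2 * (3 * C + 2))) + C * (ε / (2 * (3 * C + 2)))
        + 2 * (ε / (2 * (3 * C + 2))) = ε / 2 := by field_simp; ring
    linarith
  obtain ⟨S, hSU, hS, hνS⟩ : ∃ S ⊆ U, IsCompact S ∧ 1 - ENNReal.ofReal δ < ν S := by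
    refine hU.exists_lt_isCompact ?_
    rw [(prob_compl_eq_zero_iff hU.measurableSet).1 hνU]
    exact ENNReal.sub_lt_self (by simp) (by simp) (by simpa using hδ)
  have hνS' : 1 - δ < ν.real S := by
    have h1 : ENNReal.ofReal (1 - δ) < ENNReal.ofReal (ν.real S) := by
      rwa [ofReal_measureReal, ENNReal.ofReal_sub _ hδ.le, ENNReal.ofReal_one]
    exact (ENNReal.ofReal_lt_ofReal_iff'.1 h1).1
  obtain ⟨χ, hχU, hχS, hχ⟩ : ∃ χ : C(E, ℝ), tsupport χ ⊆ U ∧ Set.EqOn χ 1 S ∧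
      ∀ x, χ x ∈ Set.Icc (0 : ℝ) 1 :=
    exists_tsupport_one_of_isOpen_isClosed hU isClosed_closure.isCompact hS.isClosed hSU
  have hχφ : Continuous fun x => χ x * φ x := by
    refine continuous_of_tsupport fun x hx => ?_
    exact χ.continuous.continuousAt.mul
      (hφ.continuousAt (hU.mem_nhds (hχU (closure_mono (Function.support_mul_subset_left _ _) hx))))
  have hχi : ∀ (ρ : Measure E) [IsProbabilityMeasure ρ], Integrable χ ρ := fun ρ _ =>
    Integrable.of_bound χ.continuous.measurable.aestronglyMeasurable 1
      (Eventually.of_forall fun x => by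
        rw [Real.norm_eq_abs, abs_of_nonneg (hχ x).1]; exact (hχ x).2)
  have hνχ : 1 - δ < ∫ x, χ x ∂ν := by
    refine hνS'.trans_le ?_
    rw [← integral_indicator_one hS.measurableSet]
    refine integral_mono ?_ (hχi ν) fun x => ?_
    · exact (integrable_const (1 : ℝ)).indicator hS.measurableSet
    · by_cases hx : x ∈ S
      · simp [hx, hχS hx]
      · simp [hx, (hχ x).1]
  have hunif : ∀ᶠ i in l, ∀ x, |χ x * ψ i x - χ x * φ x| ≤ δ := by
    have key : {p : ι × E | |ψ p.1 p.2 - φ p.2| < δ} ∈ l ×ˢ 𝓝ˢ (tsupport χ) := by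
      refine (isClosed_tsupport χ).isCompact.mem_prod_nhdsSet_of_forall fun x hx => ?_
      have h1 : Tendsto (fun p : ι × E => φ p.2) (l ×ˢ 𝓝 x) (𝓝 (φ x)) :=
        (hφ.continuousAt (hU.mem_nhds (hχU hx))).tendsto.comp tendsto_snd
      have h2 := ((h x (hχU hx)).sub h1).abs
      simp only [sub_self, abs_zero] at h2
      exact h2.eventually_lt_const hδ
    have key' : ∀ᶠ p in l ×ˢ 𝓝ˢ (tsupport χ), |ψ p.1 p.2 - φ p.2| < δ := key
    filter_upwards [key'.curry] with i hi x
    by_cases hx : x ∈ tsupport χ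
    · have := hi.self_of_nhdsSet x hx
      rw [← mul_sub, abs_mul, abs_of_nonneg (hχ x).1]
      exact (mul_le_of_le_one_left (abs_nonneg _) (hχ x).2).trans this.le
    · simp [image_eq_zero_of_notMem_tsupport hx, hδ.le]
  have hrest : ∀ (ρ : Measure E) [IsProbabilityMeasure ρ] (g : E → ℝ), Integrable g ρ →
      (∀ᵐ x ∂ρ, |g x| ≤ C) →
      Integrable (fun x => χ x * g x) ρ ∧
      |∫ x, g x ∂ρ - ∫ x, χ x * g x ∂ρ| ≤ C * (1 - ∫ x, χ x ∂ρ) := by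
    intro ρ _ g hg hgC
    have hχg : Integrable (fun x => χ x * g x) ρ :=
      hg.bdd_mul (c := 1) χ.continuous.measurable.aestronglyMeasurable
        (Eventually.of_forall fun x => by
          rw [Real.norm_eq_abs, abs_of_nonneg (hχ x).1]; exact (hχ x).2)
    refine ⟨hχg, ?_⟩
    have h1 : C * (1 - ∫ x, χ x ∂ρ) = ∫ x, C * (1 - χ x) ∂ρ := by
      rw [integral_const_mul, integral_sub (integrable_const _) (hχi ρ)]; simp
    rw [← integral_sub hg hχg, h1, ← Real.norm_eq_abs]
    refine norm_integral_le_of_norm_le (g := fun x => C * (1 - χ x))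
      (((integrable_const (1 : ℝ)).sub (hχi ρ)).const_mul C) ?_
    filter_upwards [hgC] with x hx
    have : g x - χ x * g x = (1 - χ x) * g x := by ring
    rw [this, norm_mul, Real.norm_eq_abs, Real.norm_eq_abs,
      abs_of_nonneg (sub_nonneg.2 (hχ x).2), mul_comm C]
    exact mul_le_mul_of_nonneg_left hx (sub_nonneg.2 (hχ x).2)
  obtain ⟨hνi, hνle⟩ := hrest ν φ hφi (hUae.mono hφC)
  have hlim := Metric.tendsto_nhds.1 (hμ ⟨_, hχφ⟩) δ hδ
  filter_upwards [hunif, hlim, (hμ χ).eventually_const_lt hνχ] with i hi hlimi hχi'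
  obtain ⟨hii, hile⟩ := hrest (μ i) (ψ i) (hψi i) (Eventually.of_forall (hψC i))
  have hmid : |∫ x, χ x * ψ i x ∂μ i - ∫ x, χ x * φ x ∂μ i| ≤ δ := by
    have hφμ : Integrable (fun x => χ x * φ x) (μ i) :=
      hχφ.integrable_of_hasCompactSupport (HasCompactSupport.of_compactSpace _)
    rw [← integral_sub hii hφμ, ← Real.norm_eq_abs]
    simpa using norm_integral_le_of_norm_le_const (μ := μ i)
      (f := fun x => χ x * ψ i x - χ x * φ x) (Eventually.of_forall hi)
  rw [Real.dist_eq] at hlimi ⊢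
  simp only [ContinuousMap.coe_mk] at hlimi
  have e1 : C * (1 - ∫ x, χ x ∂ν) ≤ C * δ := mul_le_mul_of_nonneg_left (by linarith) hC
  have e2 : C * (1 - ∫ x, χ x ∂μ i) ≤ C * δ := mul_le_mul_of_nonneg_left (by linarith) hC
  have a1 := abs_le.1 (hile.trans e2)
  have a2 := abs_le.1 hmid
  have a3 := abs_lt.1 hlimi
  have a4 := abs_le.1 (hνle.trans e1)
  rw [abs_lt]
  constructor <;> nlinarith [mul_nonneg hC hδ.le]

/-- `jointLaw K m` as a Markov kernel. -/
def jointKernel (K : Kernel ℝ≥0 ℝ≥0) : (m : ℕ) → Kernel ℝ≥0 (Fin m → ℝ≥0)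
  | 0 => Kernel.const _ (Measure.dirac (fun i => i.elim0))
  | m + 1 => ((Kernel.id ×ₖ jointKernel K m).map fun p : ℝ≥0 × (Fin m → ℝ≥0) =>
      (Fin.cons p.1 p.2 : Fin (m + 1) → ℝ≥0)) ∘ₖ K

theorem measurable_fin_cons (m : ℕ) :
    Measurable fun p : ℝ≥0 × (Fin m → ℝ≥0) => (Fin.cons p.1 p.2 : Fin (m + 1) → ℝ≥0) := by
  refine measurable_pi_lambda _ fun i => ?_
  refine Fin.cases ?_ (fun j => ?_) i
  · exact measurable_fst
  · exact (measurable_pi_apply j).comp measurable_snd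

instance isMarkovKernel_jointKernel (K : Kernel ℝ≥0 ℝ≥0) [IsMarkovKernel K] (m : ℕ) :
    IsMarkovKernel (jointKernel K m) := by
  induction m with
  | zero => unfold jointKernel; infer_instance
  | succ m ih =>
    have := Kernel.IsMarkovKernel.map (Kernel.id ×ₖ jointKernel K m) (measurable_fin_cons m)
    unfold jointKernel
    infer_instance

theorem jointKernel_apply (K : Kernel ℝ≥0 ℝ≥0) [IsMarkovKernel K] (m : ℕ) (y : ℝ≥0) :
    jointKernel K m y = jointLaw K m y := by
  induction m generalizing y with
  | zero => rfl
  | succ m ih =>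
    rw [jointKernel, jointLaw, Kernel.comp_apply]
    congr 1
    funext x
    rw [Kernel.map_apply _ (measurable_fin_cons m), Kernel.prod_apply, Kernel.id_apply,
      Measure.dirac_prod, Measure.map_map (measurable_fin_cons m) (by fun_prop), ih]
    rfl

theorem integral_jointLaw_succ (K : Kernel ℝ≥0 ℝ≥0) [IsMarkovKernel K] (m : ℕ) (y : ℝ≥0)
    {g : (Fin (m + 1) → ℝ≥0) → ℝ} (hg : Measurable g) {C : ℝ} (hC : ∀ x, |g x| ≤ C) :
    ∫ x, g x ∂jointLaw K (m + 1) y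
      = ∫ x₁, ∫ x, g (Fin.cons x₁ x) ∂jointLaw K m x₁ ∂K y := by
  rw [← jointKernel_apply]
  have hi : Integrable g (jointKernel K (m + 1) y) :=
    Integrable.of_bound hg.aestronglyMeasurable C (Eventually.of_forall hC)
  rw [jointKernel] at hi ⊢
  rw [Kernel.integral_comp hi]
  congr 1
  funext x₁
  rw [Kernel.map_apply _ (measurable_fin_cons m),
    integral_map (measurable_fin_cons m).aemeasurable hg.aestronglyMeasurable,
    Kernel.prod_apply, Kernel.id_apply, Measure.dirac_prod,
    integral_map (f := fun p : ℝ≥0 × (Fin m → ℝ≥0) => g (Fin.cons p.1 p.2)) (by fun_prop)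
      (hg.comp (measurable_fin_cons m)).aestronglyMeasurable, jointKernel_apply]

theorem measurable_tailChain (m : ℕ) (u : ℝ≥0) :
    Measurable fun (ξ : Fin m → ℝ≥0) (i : Fin m) => u * ∏ j ∈ Finset.Iic i, ξ j := by
  fun_prop

instance isProbabilityMeasure_tailChainLaw (G : Measure ℝ≥0) [IsProbabilityMeasure G] (m : ℕ)
    (u : ℝ≥0) : IsProbabilityMeasure (tailChainLaw G m u) :=
  Measure.isProbabilityMeasure_map (measurable_tailChain m u).aemeasurable

theorem integral_tailChainLaw_succ (G : Measure ℝ≥0) [IsProbabilityMeasure G] (m : ℕ) (u : ℝ≥0)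
    {g : (Fin (m + 1) → ℝ≥0) → ℝ} (hg : Measurable g) {C : ℝ} (hC : ∀ x, |g x| ≤ C) :
    ∫ x, g x ∂tailChainLaw G (m + 1) u
      = ∫ y, ∫ x, g (Fin.cons (u * y) x) ∂tailChainLaw G m (u * y) ∂G := by
  have hcons : ∀ y, Measurable fun x : Fin m → ℝ≥0 => g (Fin.cons (u * y) x) := fun y =>
    hg.comp ((measurable_fin_cons m).comp measurable_prodMk_left)
  have hmul : ∀ p : ℝ≥0 × (Fin m → ℝ≥0),
      (fun i : Fin (m + 1) => u * ∏ j ∈ Finset.Iic i, (Fin.cons p.1 p.2 : Fin (m + 1) → ℝ≥0) j)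
        = Fin.cons (u * p.1) fun i => u * p.1 * ∏ j ∈ Finset.Iic i, p.2 j := by
    intro p
    have hIic : ∀ i : Fin m, Finset.Iic i.succ
        = Finset.cons 0 ((Finset.Iic i).map (Fin.succEmb m)) (by simp) := by
      intro i
      ext j
      refine Fin.cases ?_ (fun k => ?_) j <;> simp
    funext i
    refine Fin.cases ?_ (fun i => ?_) i
    · have : Finset.Iic (0 : Fin (m + 1)) = {0} := by ext j; simp
      simp [this]
    · rw [hIic]
      simp only [Finset.prod_cons, Finset.prod_map, Fin.coe_succEmb, Fin.cons_zero, Fin.cons_succ,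
        mul_assoc]
  have hF : Measurable fun p : ℝ≥0 × (Fin m → ℝ≥0) =>
      g (Fin.cons (u * p.1) fun i => u * p.1 * ∏ j ∈ Finset.Iic i, p.2 j) := by
    refine hg.comp ?_
    simp_rw [← hmul]
    exact (measurable_tailChain (m + 1) u).comp (measurable_fin_cons m)
  have hpres := (measurePreserving_piFinSuccAbove (fun _ : Fin (m + 1) => G) 0).symm
  rw [tailChainLaw, integral_map (measurable_tailChain _ u).aemeasurable hg.aestronglyMeasurable,
    ← hpres.integral_comp']
  calc _ = ∫ p : ℝ≥0 × (Fin m → ℝ≥0),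
        g (Fin.cons (u * p.1) fun i => u * p.1 * ∏ j ∈ Finset.Iic i, p.2 j)
          ∂(G.prod (Measure.pi fun _ : Fin m => G)) := by
        refine integral_congr_ae (Eventually.of_forall fun p => ?_)
        simp only [← hmul]
        congr 1
        funext i
        simp [MeasurableEquiv.piFinSuccAbove, Fin.insertNthEquiv]
    _ = _ := by
        rw [integral_prod _ (Integrable.of_bound hF.aestronglyMeasurable C
          (Eventually.of_forall fun p => hC _))]
        congr 1
        funext y
        rw [tailChainLaw, integral_map (measurable_tailChain _ _).aemeasurable
          (hcons y).aestronglyMeasurable]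

/-- The laws of `(X_1/t, …, X_m/t)` given `X_0 = t v` converge weakly to that of the tail chain
started from `u`, jointly as `t → ∞` and `v → u > 0`. -/
theorem tendsto_integral_jointLaw (K : Kernel ℝ≥0 ℝ≥0) [IsMarkovKernel K]
    (G : Measure ℝ≥0) [IsProbabilityMeasure G] (hK : KernelDOA K G) (hG0 : G {0} = 0)
    (m : ℕ) (f : C((Fin m → ℝ≥0∞), ℝ)) {u : ℝ≥0} (hu : 0 < u) :
    Tendsto (fun p : ℝ≥0 × ℝ≥0 =>
        ∫ x, f (fun i => ((x i / p.1 : ℝ≥0) : ℝ≥0∞)) ∂(jointLaw K m (p.1 * p.2)))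
      (atTop ×ˢ 𝓝 u) (𝓝 (∫ x, f (fun i => (x i : ℝ≥0∞)) ∂(tailChainLaw G m u))) := by
  have hprob : ∀ n y, IsProbabilityMeasure (jointLaw K n y) := fun n y => by
    rw [← jointKernel_apply]; infer_instance
  induction m generalizing u with
  | zero =>
    have hc : ∀ x, f x = f 0 := fun x => congrArg f (Subsingleton.elim _ _)
    simp [hc]
  | succ m ih =>
    set S : C(ℝ≥0∞ × (Fin m → ℝ≥0∞), ℝ) :=
      ⟨fun q => f (Fin.cons q.1 q.2), f.continuous.comp (by
        refine continuous_pi fun i => Fin.cases ?_ (fun j => ?_) i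
        · exact continuous_fst
        · exact (continuous_apply j).comp continuous_snd)⟩ with hS
    set Φ : ℝ≥0 → ℝ≥0 → ℝ := fun t w =>
      ∫ x, S (w, fun i => ((x i / t : ℝ≥0) : ℝ≥0∞)) ∂jointLaw K m (t * w) with hΦ
    set φ : ℝ≥0 → ℝ := fun w => ∫ x, S (w, fun i => (x i : ℝ≥0∞)) ∂tailChainLaw G m w with hφ
    have hscale : ∀ t : ℝ≥0, Measurable fun x : Fin m → ℝ≥0 =>
        fun i => ((x i / t : ℝ≥0) : ℝ≥0∞) := fun t => by fun_prop
    have hΦlim : ∀ w : ℝ≥0, 0 < w →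
        Tendsto (fun p : ℝ≥0 × ℝ≥0 => Φ p.1 p.2) (atTop ×ˢ 𝓝 w) (𝓝 (φ w)) := by
      intro w hw
      have h1 := ih (S.curry w) hw
      have h2 : Tendsto (fun p : ℝ≥0 × ℝ≥0 => ‖S.curry (p.2 : ℝ≥0∞) - S.curry w‖)
          (atTop ×ˢ 𝓝 w) (𝓝 0) := by
        have : Continuous fun v : ℝ≥0 => ‖S.curry (v : ℝ≥0∞) - S.curry w‖ := by fun_prop
        have h0 := (this.tendsto w).comp (tendsto_snd (f := (atTop : Filter ℝ≥0)))
        rwa [sub_self, norm_zero] at h0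
      have h3 : Tendsto (fun p : ℝ≥0 × ℝ≥0 => Φ p.1 p.2
          - ∫ x, S.curry w (fun i => ((x i / p.1 : ℝ≥0) : ℝ≥0∞)) ∂(jointLaw K m (p.1 * p.2)))
          (atTop ×ˢ 𝓝 w) (𝓝 0) := by
        refine squeeze_zero_norm (fun p => ?_) h2
        have hint : ∀ v : ℝ≥0∞, Integrable
            (fun x => S.curry v (fun i => ((x i / p.1 : ℝ≥0) : ℝ≥0∞)))
            (jointLaw K m (p.1 * p.2)) := fun v =>
          Integrable.of_bound (((S.curry v).continuous.measurable.comp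
            (hscale p.1)).aestronglyMeasurable) ‖S.curry v‖
            (Eventually.of_forall fun x => (S.curry v).norm_coe_le_norm _)
        have := integral_sub (hint p.2) (hint w)
        refine (congrArg norm this.symm).le.trans ?_
        simpa using norm_integral_le_of_norm_le_const (μ := jointLaw K m (p.1 * p.2))
          (Eventually.of_forall fun x =>
            (S.curry (p.2 : ℝ≥0∞) - S.curry w).norm_coe_le_norm
              (fun i => ((x i / p.1 : ℝ≥0) : ℝ≥0∞)))
      simpa using h3.add h1
    have hΦm : ∀ t, Measurable (Φ t) := by
      intro t
      simp_rw [hΦ, ← jointKernel_apply]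
      refine (StronglyMeasurable.integral_kernel_prod_right
        (κ := (jointKernel K m).comap (fun w => t * w) (by fun_prop)) ?_).measurable
      refine (S.continuous.measurable.comp ?_).stronglyMeasurable
      exact Measurable.prodMk (by fun_prop) (by fun_prop)
    have hΦC : ∀ t w, |Φ t w| ≤ ‖S‖ := by
      intro t w
      rw [← Real.norm_eq_abs]
      simpa using norm_integral_le_of_norm_le_const (μ := jointLaw K m (t * w))
          (Eventually.of_forall fun x =>
            S.norm_coe_le_norm (w, fun i => ((x i / t : ℝ≥0) : ℝ≥0∞)))
    have hfm : ∀ t : ℝ≥0, Measurable fun x : Fin (m + 1) → ℝ≥0 =>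
        f (fun i => ((x i / t : ℝ≥0) : ℝ≥0∞)) := fun t =>
      f.continuous.measurable.comp (by fun_prop)
    have hdiv : ∀ t : ℝ≥0, Measurable fun x : ℝ≥0 => ((x / t : ℝ≥0) : ℝ≥0∞) := fun t => by
      fun_prop
    have hlt : ∀ᶠ p : ℝ≥0 × ℝ≥0 in atTop ×ˢ 𝓝 u, 0 < p.1 ∧ 0 < p.2 :=
      (eventually_gt_atTop 0).prod_mk (lt_mem_nhds hu)
    have hlim : ∫ x, f (fun i => (x i : ℝ≥0∞)) ∂(tailChainLaw G (m + 1) u)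
        = ∫ y, φ (u * y.toNNReal) ∂(G.map ((↑) : ℝ≥0 → ℝ≥0∞)) := by
      have hf0 : Measurable fun x : Fin (m + 1) → ℝ≥0 => f (fun i => (x i : ℝ≥0∞)) :=
        f.continuous.measurable.comp (by fun_prop)
      rw [integral_tailChainLaw_succ G m u hf0 (fun x => f.norm_coe_le_norm _),
        ENNReal.isOpenEmbedding_coe.measurableEmbedding.integral_map]
      congr 1
      funext y
      simp only [ENNReal.toNNReal_coe, hφ, hS, ContinuousMap.coe_mk]
      congr 1
      funext x
      refine congrArg f (funext fun i => Fin.cases ?_ (fun j => ?_) i) <;> simp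
    have hpre : ∀ᶠ p : ℝ≥0 × ℝ≥0 in atTop ×ˢ 𝓝 u,
        ∫ y, Φ p.1 (p.2 * y.toNNReal) ∂((K (p.1 * p.2)).map
            fun x => ((x / (p.1 * p.2) : ℝ≥0) : ℝ≥0∞))
          = ∫ x, f (fun i => ((x i / p.1 : ℝ≥0) : ℝ≥0∞)) ∂(jointLaw K (m + 1) (p.1 * p.2)) := by
      filter_upwards [hlt] with p ⟨hp1, hp2⟩
      have hΦp : Measurable fun y : ℝ≥0∞ => Φ p.1 (p.2 * y.toNNReal) :=
        (hΦm p.1).comp (by fun_prop)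
      rw [integral_jointLaw_succ K m _ (hfm p.1) (fun x => f.norm_coe_le_norm _),
        integral_map (hdiv _).aemeasurable hΦp.aestronglyMeasurable]
      congr 1
      funext x₁
      have e1 : p.2 * (x₁ / (p.1 * p.2)) = x₁ / p.1 := by field_simp
      have e2 : p.1 * (x₁ / p.1) = x₁ := by field_simp
      simp only [ENNReal.toNNReal_coe, hΦ, hS, ContinuousMap.coe_mk, e1, e2]
      congr 1
      funext x
      refine congrArg f (funext fun i => Fin.cases ?_ (fun j => ?_) i) <;> simp
    rw [hlim]
    refine Tendsto.congr' hpre ?_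
    have : ∀ p : ℝ≥0 × ℝ≥0, IsProbabilityMeasure ((K (p.1 * p.2)).map
            fun x => ((x / (p.1 * p.2) : ℝ≥0) : ℝ≥0∞)) := fun p =>
      Measure.isProbabilityMeasure_map (hdiv _).aemeasurable
    have : IsProbabilityMeasure (G.map ((↑) : ℝ≥0 → ℝ≥0∞)) :=
      Measure.isProbabilityMeasure_map (by fun_prop)
    refine tendsto_integral_of_tendsto_prod_nhds (E := ℝ≥0∞) (U := Set.Ioo 0 ⊤) ?_ isOpen_Ioo ?_
      (ψ := fun (p : ℝ≥0 × ℝ≥0) y => Φ p.1 (p.2 * y.toNNReal)) (fun p => (hΦm p.1).comp (by fun_prop))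
      (fun p y => hΦC _ _) ?_
    · intro g
      have hmul : Tendsto (fun p : ℝ≥0 × ℝ≥0 => p.1 * p.2) (atTop ×ˢ 𝓝 u) atTop :=
        tendsto_fst.atTop_mul_pos hu tendsto_snd
      rw [integral_map (by fun_prop) g.continuous.measurable.aestronglyMeasurable]
      refine ((hK g).comp hmul).congr fun p => ?_
      rw [integral_map (hdiv _).aemeasurable g.continuous.measurable.aestronglyMeasurable]
      rfl
    · rw [Measure.map_apply (by fun_prop) measurableSet_Ioo.compl]
      convert hG0 using 2
      ext x
      simp
    · rintro y ⟨hy0, hyt⟩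
      refine (hΦlim (u * y.toNNReal) (mul_pos hu (ENNReal.toNNReal_pos hy0.ne' hyt.ne))).comp
        (f := fun q : (ℝ≥0 × ℝ≥0) × ℝ≥0∞ => (q.1.1, q.1.2 * q.2.toNNReal)) ?_
      exact (tendsto_fst.comp tendsto_fst).prodMk ((tendsto_snd.comp tendsto_fst).mul
        ((ENNReal.tendsto_toNNReal hyt.ne).comp tendsto_snd))

/-- If `G({0}) = 0`, then conditional on `X_0 = t u_t` with `u_t → u > 0`, the laws of
`(X_1/t, …, X_m/t)` converge weakly on `[0,∞]^m` to the law of the tail chain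
`(T*_1, …, T*_m)` started from `u`. -/
theorem fdd_weak_convergence_of_G_no_atom_at_zero (K : Kernel ℝ≥0 ℝ≥0) [IsMarkovKernel K]
    (G : Measure ℝ≥0) [IsProbabilityMeasure G] (hK : KernelDOA K G)
    (hG0 : G {0} = 0) (m : ℕ) (hm : 1 ≤ m)
    (u : ℝ≥0) (hu : 0 < u) (ut : ℝ≥0 → ℝ≥0) (hut : Tendsto ut atTop (𝓝 u))
    (f : C((Fin m → ℝ≥0∞), ℝ)) :
    Tendsto (fun t : ℝ≥0 =>
        ∫ x, f (fun i => ((x i / t : ℝ≥0) : ℝ≥0∞)) ∂(jointLaw K m (t * ut t)))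
      atTop
      (𝓝 (∫ x, f (fun i => (x i : ℝ≥0∞)) ∂(tailChainLaw G m u))) := by
  exact (tendsto_integral_jointLaw K G hK hG0 m f hu).comp (tendsto_id.prodMk hut)
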